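/- Let p be an odd prime and m a positive integer, and set [p] = 1 + q + ⋯ + q^{p-1}. Then, in the ring of Laurent polynomials Z[q, q^{-1}], the sum ∑_{k=0}^{p-1} ((1-q^{2k+1})/(1-q)) D_q(m,k) D_{q^{-1}}(m,k) q^{-k} is congruent modulo [p]^2 (i.e., the difference is [p]^2 times a Laurent polynomial with integer coefficients) to: q(1-q^{-2m})/(1-q^2) if m ≡ 0 (mod p); q(1-q^{2m+2})/(1-q^2) if m ≡ -1 (mod p); and 0 otherwise. -/

import Mathlib

open Finset

/-- The q-Pochhammer symbol `(a;q)_n = ∏_{j=0}^{n-1} (1 - a q^j)`. -/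
noncomputable def qPoch {F : Type*} [Field F] (q a : F) (n : ℕ) : F :=
  ∏ j ∈ Finset.range n, (1 - a * q ^ j)

/-- The q-binomial coefficient `[n choose k]_q`, which is
`(q;q)_n / ((q;q)_k (q;q)_{n-k})` for `0 ≤ k ≤ n` and `0` otherwise. -/
noncomputable def qBin {F : Type*} [Field F] (q : F) (n k : ℕ) : F :=
  if k ≤ n then qPoch q q n / (qPoch q q k * qPoch q q (n - k)) else 0

/-- The q-Delannoy number `D_q(m,n) = ∑_{k=0}^n q^{k(k-1)/2} [n,k]_q [n+m-k,n]_q`. -/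
noncomputable def Dq {F : Type*} [Field F] (q : F) (m n : ℕ) : F :=
  ∑ k ∈ Finset.range (n + 1), q ^ (k * (k - 1) / 2) * qBin q n k * qBin q (n + m - k) n

/-- The q-Delannoy number of the second kind
`D*_q(m,n) = ∑_{k=0}^n q^{k(k+1)/2} [n,k]_q [n+m-k,n]_q`. -/
noncomputable def Dstar {F : Type*} [Field F] (q : F) (m n : ℕ) : F :=
  ∑ k ∈ Finset.range (n + 1), q ^ (k * (k + 1) / 2) * qBin q n k * qBin q (n + m - k) n

/-- The field of rational functions `ℚ(q)`. -/
abbrev Fq : Type := FractionRing (Polynomial ℚ)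

noncomputable def q : Fq := algebraMap (Polynomial ℚ) Fq Polynomial.X

/-- `[p] = 1 + q + ⋯ + q^{p-1}`. -/
noncomputable def qInt (p : ℕ) : Fq := ∑ i ∈ Finset.range p, q ^ i


section prodformula
variable {F : Type*} [Field F]

noncomputable def pa (q M : F) (j : ℕ) : F := ∏ i ∈ range j, (1 - M * q ^ i)
noncomputable def pb (q M : F) (j : ℕ) : F := ∏ i ∈ range j, (1 - M / q ^ (i+1))
noncomputable def phi (q M : F) (j : ℕ) : F := pa q (q*M) j * pb q (q*M) j / M ^ j
noncomputable def Psi (q M : F) (j : ℕ) : F := pa q M (j+1) * pb q M j / M ^ j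
noncomputable def ww (q : F) (j : ℕ) : F :=
  ∏ i ∈ range j, (q ^ (2*i+1) * (1 + q ^ i) / ((1 - q ^ (i+1))^3 * (1 - q ^ (2*i+1))))
noncomputable def kk (q : F) (j : ℕ) : F := ww q j * q ^ j / (1 - q ^ (2*j+1))

lemma pa_succ (q M : F) (j : ℕ) : pa q M (j+1) = pa q M j * (1 - M * q ^ j) := prod_range_succ _ _
lemma pb_succ (q M : F) (j : ℕ) : pb q M (j+1) = pb q M j * (1 - M / q ^ (j+1)) := prod_range_succ _ _
lemma ww_succ (q : F) (j : ℕ) : ww q (j+1) = ww q j *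
  (q ^ (2*j+1) * (1 + q ^ j) / ((1 - q ^ (j+1))^3 * (1 - q ^ (2*j+1)))) := prod_range_succ _ _
lemma pa_shift (q M : F) (j : ℕ) : pa q M (j+1) = (1 - M) * pa q (q*M) j := by
  unfold pa
  rw [prod_range_succ']
  simp only [pow_zero, mul_one]
  rw [mul_comm]
  congr 1
  apply prod_congr rfl; intros; ring
lemma pb_shift (q M : F) (hq : q ≠ 0) (j : ℕ) : pb q (q*M) (j+1) = (1 - M) * pb q M j := by
  unfold pb
  rw [prod_range_succ', mul_comm]
  congr 1
  · rw [zero_add, pow_one, mul_div_cancel_left₀ _ hq]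
  apply prod_congr rfl; intros; field_simp; try ring

lemma phi_succ (q N : F) (hN : N ≠ 0) (hq : q ≠ 0) (j : ℕ) : phi q N (j+1) = phi q N j *
   ((1 - N * q^(j+1)) * (1 - N / q ^ j) / N) := by
  unfold phi
  rw [pa_succ, pb_succ]
  field_simp
  try ring

set_option maxRecDepth 20000 in
set_option maxHeartbeats 4000000 in
lemma partial_sum (q L N : F) (hq : q ≠ 0) (h1 : ∀ k, q ^ (k+1) ≠ 1) (hL : L ≠ 0) (hN : N ≠ 0) (J : ℕ) :
    ∑ j ∈ range (J+1), phi q N j *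
      ((L*(1-q*N)+(1-N)) * ((1-q*N)+q*L*(1-N)) / N * (ww q j * phi q L j)
      + q * (L*(1-q*N)+(1-N)) / N * (kk q j * Psi q L j * ((1+q^j) - (1+q^(j+1))*N))
      + ((1-q*N)+q*L*(1-N)) * (kk q j * Psi q L j * ((1+q^(j+1))/N - q*(1+q^j)))
      + q * ((1-L)^2 * (ww q j * phi q (L/q) j))
      - (1-q*L)^2 * (ww q j * phi q (q*L) j)) =
    phi q N (J+1) * ((q*L+1)*(1+L) * ww q J * phi q L J
      + kk q J * Psi q L J * ((q*L+1)*(1+q^(J+1)) + (q+q*L)*(1+q^J))) := by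
  have h2 : ∀ k, 1 - q ^ (k+1) ≠ 0 := fun k h => h1 k (by linear_combination -h)
  induction J with
  | zero =>
    have := h2 0
    simp [phi_succ, hN, hq]
    simp [phi, Psi, pa, pb, kk, ww] at *
    field_simp
    ring
  | succ J ih =>
    rw [sum_range_succ, ih]
    have e1 : phi q L J = pa q (q*L) J * pb q (q*L) J / L ^ J := rfl
    have e2 : phi q L (J+1) = pa q (q*L) J * (1 - q*L*q^J) * (pb q (q*L) J * (1 - q*L/q^(J+1))) / L ^ (J+1) := by
      rw [phi, pa_succ, pb_succ]
    have e3 : Psi q L J = pa q (q*L) J * (pb q (q*L) J * (1 - q*L/q^(J+1))) / L ^ J := by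
      rw [Psi, pa_shift, ← pb_succ, pb_shift _ _ hq]; ring
    have e4 : Psi q L (J+1) = pa q (q*L) J * (1 - q*L*q^J) * (pb q (q*L) J * (1 - q*L/q^(J+1)) * (1 - q*L/q^(J+2))) / L ^ (J+1) := by
      rw [Psi, pa_shift, ← pb_succ, ← pb_succ, pb_shift _ _ hq, pa_succ]; ring
    have e5 : phi q (q*L) (J+1) = pa q (q*L) J * (1 - q*L*q^J) * (1 - q*L*q^(J+1)) * pb q (q*L) J / (q*L) ^ (J+1) := by
      rw [phi, pb_shift _ _ hq, ← pa_succ, ← pa_succ, pa_shift _ _ (J+1)]; ring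
    have e6 : phi q (L/q) (J+1) = pa q (q*L) J * (pb q (q*L) J * (1 - q*L/q^(J+1)) * (1 - q*L/q^(J+2))) / (L/q) ^ (J+1) := by
      rw [phi, mul_div_cancel₀ _ hq, ← pb_succ, ← pb_succ, pb_shift _ _ hq, pa_shift]; ring
    have e7 : kk q (J+1) = ww q (J+1) * q ^ (J+1) / (1 - q ^ (2*(J+1)+1)) := rfl
    have e8 : kk q J = ww q J * q ^ J / (1 - q ^ (2*J+1)) := rfl
    rw [phi_succ q N hN hq (J+1), e2, e4, e5, e6, e1, e3, e7, e8, ww_succ]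
    have g1 := h2 J
    have g2 := h2 (2*J)
    have g3 := h2 (2*J+2)
    generalize pa q (q*L) J = a
    generalize pb q (q*L) J = b
    generalize ww q J = w
    generalize phi q N (J+1) = f
    have p1 : q ^ (J+1) = q^J * q := by ring
    have p2 : q ^ (J+2) = q^J * q^2 := by ring
    have p3 : q ^ (2*J+1) = (q^J)^2 * q := by ring
    have p4 : q ^ (2*(J+1)+1) = (q^J)^2 * q^3 := by ring
    have p5 : L ^ (J+1) = L^J * L := by ring
    have p6 : q ^ (J+1+1) = q^J * q^2 := by ring
    have p7 : (L/q) ^ (J+1) = L^J * L/(q^J*q) := by rw [div_pow]; ring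
    have p8 : (q*L) ^ (J+1) = L^J * L*(q^J*q) := by rw [mul_pow]; ring
    rw [p1] at g1
    rw [p3] at g2
    rw [show 2*J+2+1 = 2*(J+1)+1 by ring, p4] at g3
    have hQ : q^J ≠ 0 := pow_ne_zero _ hq
    have hLJ : L^J ≠ 0 := pow_ne_zero _ hL
    rw [p7, p8, p1, p2, p3, p4, p5]
    generalize q^J = Q at *
    generalize L^J = LJ at *
    clear ih e1 e2 e3 e4 e5 e6 e7 e8 p1 p2 p3 p4 p5 p6 p7 p8
    obtain ⟨d1, hd1⟩ : ∃ d, d = 1 - Q * q := ⟨_, rfl⟩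
    obtain ⟨d2, hd2⟩ : ∃ d, d = 1 - Q^2 * q := ⟨_, rfl⟩
    obtain ⟨d3, hd3⟩ : ∃ d, d = 1 - Q^2 * q^3 := ⟨_, rfl⟩
    rw [← hd1] at g1
    rw [← hd2] at g2
    rw [← hd3] at g3
    rw [← hd1, ← hd2, ← hd3]
    field_simp
    rw [hd1, hd2, hd3]
    ring

lemma T_step (q L N : F) (hq : q ≠ 0) (h1 : ∀ k, q ^ (k+1) ≠ 1) (hL : L ≠ 0) (hN : N ≠ 0) (j : ℕ) :
   kk q j * Psi q (q*L) j * ((1+q^j) - (1+q^(j+1))*N) =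
   (L*(1-q*N)+(1-N)) * (ww q j * phi q L j) + N * (kk q j * Psi q L j * ((1+q^(j+1))/N - q*(1+q^j))) := by
  have h2 : ∀ k, 1 - q ^ (k+1) ≠ 0 := fun k h => h1 k (by linear_combination -h)
  have e3 : Psi q L j = pa q (q*L) j * (pb q (q*L) j * (1 - q*L/q^(j+1))) / L ^ j := by
      rw [Psi, pa_shift, ← pb_succ, pb_shift _ _ hq]; ring
  have e5 : Psi q (q*L) j = pa q (q*L) j * (1 - q*L*q^j) * pb q (q*L) j / (q*L) ^ j := by
      rw [Psi, pa_succ]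
  have g2 := h2 (2*j)
  rw [e3, e5, phi, kk]
  generalize pa q (q*L) j = a
  generalize pb q (q*L) j = b
  have p1 : q ^ (j+1) = q^j * q := by ring
  have p3 : q ^ (2*j+1) = (q^j)^2 * q := by ring
  have hQ : q^j ≠ 0 := pow_ne_zero _ hq
  have hLJ : L^j ≠ 0 := pow_ne_zero _ hL
  rw [p3] at g2
  rw [p3, p1, mul_pow]
  clear e3 e5 p1 p3
  generalize q^j = Q at *
  generalize L^j = LJ at *
  field_simp
  ring

lemma U_step (q L N : F) (hq : q ≠ 0) (h1 : ∀ k, q ^ (k+1) ≠ 1) (hL : L ≠ 0) (hN : N ≠ 0) (j : ℕ) :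
   N * (kk q j * Psi q (q*L) j * ((1+q^(j+1))/N - q*(1+q^j))) =
   ((1-q*N)+q*L*(1-N)) * (ww q j * phi q L j) + q * (kk q j * Psi q L j * ((1+q^j) - (1+q^(j+1))*N)) := by
  have h2 : ∀ k, 1 - q ^ (k+1) ≠ 0 := fun k h => h1 k (by linear_combination -h)
  have e3 : Psi q L j = pa q (q*L) j * (pb q (q*L) j * (1 - q*L/q^(j+1))) / L ^ j := by
      rw [Psi, pa_shift, ← pb_succ, pb_shift _ _ hq]; ring
  have e5 : Psi q (q*L) j = pa q (q*L) j * (1 - q*L*q^j) * pb q (q*L) j / (q*L) ^ j := by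
      rw [Psi, pa_succ]
  have g2 := h2 (2*j)
  rw [e3, e5, phi, kk]
  generalize pa q (q*L) j = a
  generalize pb q (q*L) j = b
  have p1 : q ^ (j+1) = q^j * q := by ring
  have p3 : q ^ (2*j+1) = (q^j)^2 * q := by ring
  have hQ : q^j ≠ 0 := pow_ne_zero _ hq
  have hLJ : L^j ≠ 0 := pow_ne_zero _ hL
  rw [p3] at g2
  rw [p3, p1, mul_pow]
  clear e3 e5 p1 p3
  generalize q^j = Q at *
  generalize L^j = LJ at *
  field_simp
  ring
end prodformula
section recurrence
variable {F : Type*} [Field F]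

lemma qPoch_ne (q : F) (h1 : ∀ k, q ^ (k+1) ≠ 1) (n : ℕ) : qPoch q q n ≠ 0 := by
  unfold qPoch
  rw [prod_ne_zero_iff]
  intro k _ h
  exact h1 k (by rw [pow_succ']; linear_combination -h)

lemma qPoch_succ (q : F) (n : ℕ) : qPoch q q (n+1) = qPoch q q n * (1 - q ^ (n+1)) := by
  unfold qPoch; rw [prod_range_succ, pow_succ']

lemma e_rec (q : F) (h1 : ∀ k, q ^ (k+1) ≠ 1) (n k : ℕ) :
    (1 - q ^ (k+1)) * (q ^ ((k+1) * (k+1-1) / 2) * qBin q n (k+1)) =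
      (q ^ k - q ^ n) * (q ^ (k * (k-1) / 2) * qBin q n k) := by
  have h2 : ∀ k, 1 - q ^ (k+1) ≠ 0 := fun k h => h1 k (by linear_combination -h)
  have hk : (k+1) * (k+1-1) / 2 = k * (k-1) / 2 + k := by
    have := Finset.sum_range_succ (fun i => i) k
    rw [Finset.sum_range_id, Finset.sum_range_id] at this
    exact this
  rw [hk]
  rcases lt_trichotomy k n with h | h | h
  · obtain ⟨d, rfl⟩ := Nat.exists_eq_add_of_lt h
    rw [qBin, qBin, if_pos (by omega), if_pos (by omega), show k + d + 1 - (k+1) = d by omega,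
      show k + d + 1 - k = d + 1 by omega, qPoch_succ q k, qPoch_succ q d]
    have a1 := qPoch_ne q h1 k
    have a2 := qPoch_ne q h1 d
    have a3 := h2 k
    have a4 := h2 d
    have : q ^ (k + d + 1) = q ^ k * q ^ (d+1) := by ring
    have : q ^ (k * (k-1)/2 + k) = q ^ (k * (k-1)/2) * q^k := by ring
    rw [this]
    field_simp
    ring
  · subst h
    rw [qBin, if_neg (by omega)]; ring
  · rw [qBin, qBin, if_neg (by omega), if_neg (by omega)]; ring

lemma h_rec (q : F) (h1 : ∀ k, q ^ (k+1) ≠ 1) (n i : ℕ) :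
    (1 - q ^ (i+1)) * qBin q (n + (i+1)) n = (1 - q ^ (n+i+1)) * qBin q (n+i) n := by
  have h2 : ∀ k, 1 - q ^ (k+1) ≠ 0 := fun k h => h1 k (by linear_combination -h)
  rw [qBin, qBin, if_pos (by omega), if_pos (by omega), show n + (i+1) - n = i+1 by omega,
    show n + i - n = i by omega, ← add_assoc, qPoch_succ, qPoch_succ]
  have a1 := qPoch_ne q h1 n
  have a2 := qPoch_ne q h1 i
  have a3 := h2 i
  field_simp

noncomputable def Es (q : F) (n : ℕ) : PowerSeries F :=
  PowerSeries.mk fun k => q ^ (k * (k-1) / 2) * qBin q n k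
noncomputable def Hs (q : F) (n : ℕ) : PowerSeries F :=
  PowerSeries.mk fun i => qBin q (n+i) n

open PowerSeries in
lemma coeff_EH (q : F) (m n : ℕ) : coeff m (Es q n * Hs q n) = Dq q m n := by
  rw [coeff_mul, Finset.Nat.sum_antidiagonal_eq_sum_range_succ_mk]
  simp only [Es, Hs, coeff_mk]
  unfold Dq
  have l1 : ∑ k ∈ range (m+1), q ^ (k * (k-1) / 2) * qBin q n k * qBin q (n + (m-k)) n =
      ∑ k ∈ range (n+m+1), q ^ (k * (k-1) / 2) * qBin q n k * qBin q (n + m - k) n := by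
    rw [← Finset.sum_subset (s₁ := range (m+1)) (s₂ := range (n+m+1))]
    · apply sum_congr rfl
      intro k hk
      rw [mem_range] at hk
      rw [show n + m - k = n + (m - k) by omega]
    · intro x hx; rw [mem_range] at *; omega
    · intro x hx hx'
      rw [mem_range] at *
      by_cases hxn : x ≤ n
      · rw [qBin.eq_def q (n+m-x), if_neg (by omega), mul_zero]
      · rw [qBin.eq_def q n x, if_neg (by omega), mul_zero, zero_mul]
  rw [l1]
  symm
  apply Finset.sum_subset
  · intro x hx; rw [mem_range] at *; omega
  · intro x hx hx'
    rw [mem_range] at *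
    rw [qBin.eq_def q n x, if_neg (by omega), mul_zero, zero_mul]

open PowerSeries in
lemma Es_eq (q : F) (h1 : ∀ k, q ^ (k+1) ≠ 1) (n : ℕ) :
    (1 + X) * rescale q (Es q n) = (1 + C (q^n) * X) * Es q n := by
  ext k
  rw [add_mul, add_mul, mul_assoc, one_mul, one_mul, map_add, map_add, coeff_C_mul]
  cases k with
  | zero => simp [Es]
  | succ k =>
    rw [coeff_succ_X_mul, coeff_succ_X_mul, coeff_rescale, coeff_rescale, Es, coeff_mk, coeff_mk]
    linear_combination -e_rec q h1 n k

open PowerSeries in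
lemma Hs_eq (q : F) (h1 : ∀ k, q ^ (k+1) ≠ 1) (n : ℕ) :
    (1 - C (q^(n+1)) * X) * rescale q (Hs q n) = (1 - X) * Hs q n := by
  ext k
  rw [sub_mul, sub_mul, mul_assoc, one_mul, one_mul, map_sub, map_sub, coeff_C_mul]
  cases k with
  | zero => simp [Hs]
  | succ k =>
    rw [coeff_succ_X_mul, coeff_succ_X_mul, coeff_rescale, coeff_rescale, Hs, coeff_mk, coeff_mk]
    have := h_rec q h1 n k
    have e : q ^ (n + k + 1) = q ^ (n+1) * q ^ k := by ring
    rw [e] at this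
    linear_combination -this

open PowerSeries in
lemma D_rec (q : F) (h1 : ∀ k, q ^ (k+1) ≠ 1) (n m : ℕ) :
    (1 - q^(m+1)) * Dq q (m+1) n =
      (q^m * (1 - q * q^n) + (1 - q^n)) * Dq q m n + q^n * (1 - q^m) * Dq q (m-1) n := by
  have h : (1 + C (1 - q^(n+1)) * X - C (q^(n+1)) * (X * X)) * rescale q (Es q n * Hs q n) =
      (1 + C (q^n - 1) * X - C (q^n) * (X * X)) * (Es q n * Hs q n) := by
    rw [map_mul, map_sub, map_sub, map_one]
    linear_combination (1 - C (q^(n+1)) * X) * rescale q (Hs q n) * Es_eq q h1 n +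
      (1 + C (q^n) * X) * Es q n * Hs_eq q h1 n
  have h' := congrArg (coeff (m+1)) h
  simp only [sub_mul, add_mul, mul_assoc, one_mul, map_add, map_sub, coeff_C_mul,
    coeff_succ_X_mul, coeff_rescale, coeff_EH] at h'
  cases m with
  | zero =>
    simp only [coeff_zero_X_mul] at h'
    simp only [pow_zero] at *
    linear_combination -h'
  | succ m =>
    simp only [coeff_succ_X_mul, coeff_rescale, coeff_EH] at h'
    simp only [Nat.add_sub_cancel]
    linear_combination -h'

lemma Dq_zero (q : F) (h1 : ∀ k, q ^ (k+1) ≠ 1) (n : ℕ) : Dq q 0 n = 1 := by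
  rw [← coeff_EH, PowerSeries.coeff_mul, Finset.Nat.antidiagonal_zero, sum_singleton]
  have := qPoch_ne q h1 n
  simp [Es, Hs, qBin]
  simp [qPoch] at *
  field_simp

lemma phi_zero_of_lt (q : F) (hq : q ≠ 0) (n j : ℕ) (h : n < j) : phi q (q^n) j = 0 := by
  have : pb q (q * q^n) j = 0 := by
    unfold pb
    rw [prod_eq_zero_iff]
    refine ⟨n, mem_range.2 h, ?_⟩
    rw [← pow_succ', div_self (pow_ne_zero _ hq), sub_self]
  rw [phi, this]; simp

lemma Psi_one (q : F) (j : ℕ) : Psi q 1 j = 0 := by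
  rw [Psi, pa_shift]; simp

lemma prod_all (q : F) (hq : q ≠ 0) (h1 : ∀ k, q ^ (k+1) ≠ 1) (n m : ℕ) :
    Dq q m n * Dq q⁻¹ m n = ∑ j ∈ range (n+1), ww q j * phi q (q^m) j * phi q (q^n) j ∧
    (1 - q^m) * (Dq q m n * Dq q⁻¹ (m-1) n) =
      ∑ j ∈ range (n+1), kk q j * Psi q (q^m) j * ((1+q^j) - (1+q^(j+1))*q^n) * phi q (q^n) j ∧
    (1 - q^m) * (Dq q (m-1) n * Dq q⁻¹ m n) =
      ∑ j ∈ range (n+1), kk q j * Psi q (q^m) j * ((1+q^(j+1))/q^n - q*(1+q^j)) * phi q (q^n) j ∧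
    (1 - q^m)^2 * (Dq q (m-1) n * Dq q⁻¹ (m-1) n) =
      ∑ j ∈ range (n+1), (1 - q^m)^2 * (ww q j * phi q (q^m/q) j * phi q (q^n) j) := by
  have h1' : ∀ k, q⁻¹ ^ (k+1) ≠ 1 := fun k h => h1 k (by simpa using h)
  have hN : q^n ≠ 0 := pow_ne_zero _ hq
  induction m with
  | zero =>
    refine ⟨?_, ?_, ?_, ?_⟩
    · rw [Dq_zero q h1, Dq_zero _ h1', sum_range_succ', sum_eq_zero]
      · simp [ww, phi, pa, pb]
      · intro j _
        rw [phi_zero_of_lt q hq 0 (j+1) (by omega)]; ring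
    · simp [Psi_one]
    · simp [Psi_one]
    · simp
  | succ m ih =>
    obtain ⟨iX, iT, iU, iY⟩ := ih
    have hL : q^m ≠ 0 := pow_ne_zero _ hq
    have hM : 1 - q^(m+1) ≠ 0 := fun h => h1 m (by linear_combination -h)
    have r1 := D_rec q h1 n m
    have r2 : q^n * (1 - q^(m+1)) * Dq q⁻¹ (m+1) n =
        ((1 - q*q^n) + q * q^m * (1 - q^n)) * Dq q⁻¹ m n + q * (1 - q^m) * Dq q⁻¹ (m-1) n := by
      have := D_rec q⁻¹ h1' n m
      simp only [inv_pow] at this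
      have e : q ^ (m+1) = q * q^m := pow_succ' _ _
      rw [e] at this
      rw [e]
      clear iX iT iU iY r1 e
      generalize Dq q⁻¹ (m+1) n = x at *
      generalize Dq q⁻¹ m n = y at *
      generalize Dq q⁻¹ (m-1) n = z at *
      generalize q^m = L at *
      generalize q^n = N at *
      field_simp at this
      linear_combination -this
    have jT : (1 - q^(m+1)) * (Dq q (m+1) n * Dq q⁻¹ m n) =
      ∑ j ∈ range (n+1), kk q j * Psi q (q^(m+1)) j * ((1+q^j) - (1+q^(j+1))*q^n) * phi q (q^n) j := by
      have : (1 - q^(m+1)) * (Dq q (m+1) n * Dq q⁻¹ m n) =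
        (q^m * (1 - q * q^n) + (1 - q^n)) * (Dq q m n * Dq q⁻¹ m n) +
          q^n * ((1 - q^m) * (Dq q (m-1) n * Dq q⁻¹ m n)) := by
        linear_combination Dq q⁻¹ m n * r1
      rw [this, iX, iU, mul_sum, mul_sum, ← sum_add_distrib]
      apply sum_congr rfl
      intro j _
      rw [pow_succ' q m, T_step q (q^m) (q^n) hq h1 hL hN j]
      ring
    have jU : (1 - q^(m+1)) * (Dq q m n * Dq q⁻¹ (m+1) n) =
      ∑ j ∈ range (n+1), kk q j * Psi q (q^(m+1)) j * ((1+q^(j+1))/q^n - q*(1+q^j)) * phi q (q^n) j := by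
      have : q^n * ((1 - q^(m+1)) * (Dq q m n * Dq q⁻¹ (m+1) n)) =
        ((1 - q*q^n) + q * q^m * (1 - q^n)) * (Dq q m n * Dq q⁻¹ m n) +
          q * ((1 - q^m) * (Dq q m n * Dq q⁻¹ (m-1) n)) := by
        linear_combination Dq q m n * r2
      apply mul_left_cancel₀ hN
      rw [this, iX, iT, mul_sum, mul_sum, ← sum_add_distrib, mul_sum]
      apply sum_congr rfl
      intro j _
      have := U_step q (q^m) (q^n) hq h1 hL hN j
      rw [pow_succ' q m]
      linear_combination -phi q (q^n) j * this
    refine ⟨?_, jT, jU, ?_⟩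
    · apply mul_left_cancel₀ (pow_ne_zero 2 hM)
      have hh : (1 - q^(m+1))^2 * (Dq q (m+1) n * Dq q⁻¹ (m+1) n) =
        (q^m*(1-q*q^n)+(1-q^n)) * ((1-q*q^n)+q*q^m*(1-q^n)) / q^n * (Dq q m n * Dq q⁻¹ m n)
        + q * (q^m*(1-q*q^n)+(1-q^n)) / q^n * ((1 - q^m) * (Dq q m n * Dq q⁻¹ (m-1) n))
        + ((1-q*q^n)+q*q^m*(1-q^n)) * ((1 - q^m) * (Dq q (m-1) n * Dq q⁻¹ m n))
        + q * ((1 - q^m)^2 * (Dq q (m-1) n * Dq q⁻¹ (m-1) n)) := by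
        have : q^n * ((1 - q^(m+1))^2 * (Dq q (m+1) n * Dq q⁻¹ (m+1) n)) = 
          ((1 - q^(m+1)) * Dq q (m+1) n) * (q^n * (1 - q^(m+1)) * Dq q⁻¹ (m+1) n) := by ring
        rw [r1, r2] at this
        apply mul_left_cancel₀ hN
        rw [this]
        generalize q^n = N at *
        field_simp
        ring
      have ps := partial_sum q (q^m) (q^n) hq h1 hL hN n
      rw [phi_zero_of_lt q hq n (n+1) (by omega), zero_mul] at ps
      rw [hh, iX, iT, iU, iY, mul_sum, mul_sum, mul_sum, mul_sum, mul_sum, ← sum_add_distrib,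
        ← sum_add_distrib, ← sum_add_distrib, ← sub_eq_zero, ← sum_sub_distrib, ← ps]
      apply sum_congr rfl
      intro j _
      rw [pow_succ' q m]
      ring
    · simp only [Nat.add_sub_cancel]
      rw [iX, mul_sum, pow_succ' q m, mul_div_cancel_left₀ _ hq]

lemma tele (q : F) (hq : q ≠ 0) (h1 : ∀ k, q ^ (k+1) ≠ 1) (j K : ℕ) :
    ∑ k ∈ range K, (1 - q^(2*k+1)) * (q^k)⁻¹ * phi q (q^k) j =
      q^(j+1) * phi q (q^K) j * (1 - q^K) * (1 - q^K/q^j) / (q^K * (1 - q^(j+1))) := by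
  have h2 : 1 - q ^ (j+1) ≠ 0 := fun h => h1 j (by linear_combination -h)
  induction K with
  | zero => simp
  | succ K ih =>
    rw [sum_range_succ, ih]
    have key : phi q (q*q^K) j * (1 - q*q^K) * (1 - q*q^K/q^j) =
        phi q (q^K) j * (1 - q*q^K) * (1 - q^K*q^(j+1)) / q^j := by
      have e1 : pa q (q*(q*q^K)) j * (1 - q*q^K) = pa q (q*q^K) j * (1 - q*q^K*q^j) := by
        rw [mul_comm, ← pa_shift, pa_succ]
      have e2 : pb q (q*(q*q^K)) j * (1 - q*(q*q^K)/q^(j+1)) = (1 - q*q^K) * pb q (q*q^K) j := by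
        rw [← pb_succ, pb_shift _ _ hq]
      have e3 : q*(q*q^K)/q^(j+1) = q*q^K/q^j := by
        rw [pow_succ' q j]; field_simp
      rw [e3] at e2
      rw [phi, phi]
      calc _ = (pa q (q*(q*q^K)) j * (1 - q*q^K)) * (pb q (q*(q*q^K)) j * (1 - q*q^K/q^j)) / (q*q^K)^j := by ring
        _ = _ := by rw [e1, e2, mul_pow, pow_succ' q j]; field_simp
    have hN : q^K ≠ 0 := pow_ne_zero _ hq
    have hQ : q^j ≠ 0 := pow_ne_zero _ hq
    have e : q^(j+1) * phi q (q^(K+1)) j * (1 - q^(K+1)) * (1 - q^(K+1)/q^j) =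
       q^(j+1) * (phi q (q*q^K) j * (1 - q*q^K) * (1 - q*q^K/q^j)) := by
      rw [pow_succ' q K]; ring
    rw [e, key]
    have p1 : q^(2*K+1) = (q^K)^2 * q := by ring
    rw [p1, pow_succ' q K]
    rw [pow_succ' q j] at *
    generalize phi q (q^K) j = f
    clear ih key e p1
    generalize q^K = N at *
    generalize q^j = Q at *
    field_simp
    ring

lemma main_sum (q : F) (hq : q ≠ 0) (h1 : ∀ k, q ^ (k+1) ≠ 1) (m p : ℕ) :
    ∑ k ∈ range p, (1 - q ^ (2 * k + 1)) / (1 - q) * Dq q m k * Dq q⁻¹ m k * (q ^ k)⁻¹ =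
    ∑ j ∈ range p, ww q j * phi q (q^m) j *
      (q^(j+1) * phi q (q^p) j * (1 - q^p) * (1 - q^p/q^j) / (q^p * (1 - q^(j+1)))) / (1 - q) := by
  simp_rw [← tele q hq h1]
  simp_rw [mul_sum, sum_div]
  rw [sum_comm]
  apply sum_congr rfl
  intro k hk
  rw [mem_range] at hk
  have : Dq q m k * Dq q⁻¹ m k = ∑ j ∈ range p, ww q j * phi q (q^m) j * phi q (q^k) j := by
    rw [(prod_all q hq h1 k m).1]
    apply sum_subset
    · intro x hx; rw [mem_range] at *; omega
    · intro x _ hx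
      rw [phi_zero_of_lt q hq k x (by rw [mem_range] at hx; omega), mul_zero]
  rw [mul_assoc (_ / _), this, mul_sum, sum_mul]
  apply sum_congr rfl
  intro j _
  ring
end recurrence
section arith
open Polynomial

noncomputable def iot : ℤ[X] →+* Fq :=
  (algebraMap (Polynomial ℚ) Fq).comp (Polynomial.mapRingHom (Int.castRingHom ℚ))

lemma iot_inj : Function.Injective iot := by
  unfold iot
  rw [RingHom.coe_comp]
  exact (IsFractionRing.injective (Polynomial ℚ) Fq).comp
    (Polynomial.map_injective _ (Int.cast_injective))

lemma iot_X : iot X = q := by simp [iot, q]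

lemma q_ne : q ≠ 0 := by
  rw [← iot_X]; intro h
  exact X_ne_zero (iot_inj (h.trans (map_zero iot).symm))

lemma q_pow_ne (k : ℕ) : q ^ (k+1) ≠ 1 := by
  rw [← iot_X, ← map_pow, ← map_one iot]
  intro h
  have := congrArg natDegree (iot_inj h)
  simp at this

lemma one_sub_q_pow_ne (k : ℕ) : 1 - q ^ (k+1) ≠ 0 := fun h => q_pow_ne k (by linear_combination -h)

lemma qInt_eq (p : ℕ) (hp : p.Prime) : qInt p = iot (cyclotomic p ℤ) := by
  have := Fact.mk hp
  rw [cyclotomic_prime, map_sum, qInt]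
  simp [iot_X]

lemma qInt_ne (p : ℕ) (hp : p.Prime) : qInt p ≠ 0 := by
  rw [qInt_eq p hp]; intro h
  exact cyclotomic_ne_zero p ℤ (iot_inj (h.trans (map_zero iot).symm))

lemma qInt_mul (p : ℕ) : 1 - q ^ p = qInt p * (1 - q) := by
  rw [qInt, geom_sum_mul_neg]

def Ev (z : ℂ) (x : Fq) (c : ℂ) : Prop :=
  ∃ a b : ℤ[X], aeval z b ≠ 0 ∧ x * iot b = iot a ∧ c * aeval z b = aeval z a

variable {z : ℂ}

lemma Ev_iot (z : ℂ) (a : ℤ[X]) : Ev z (iot a) (aeval z a) :=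
  ⟨a, 1, by simp, by simp, by simp⟩
lemma Ev_one (z : ℂ) : Ev z 1 1 := by simpa using Ev_iot z 1
lemma Ev_zero (z : ℂ) : Ev z 0 0 := by simpa using Ev_iot z 0
lemma Ev_q (z : ℂ) : Ev z q z := by simpa [iot_X] using Ev_iot z X
lemma Ev.add {x y : Fq} {c d : ℂ} (h : Ev z x c) (k : Ev z y d) : Ev z (x+y) (c+d) := by
  obtain ⟨a, b, h1, h2, h3⟩ := h
  obtain ⟨a', b', k1, k2, k3⟩ := k
  refine ⟨a*b'+a'*b, b*b', by rw [map_mul]; exact mul_ne_zero h1 k1, ?_, ?_⟩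
  · simp only [map_add, map_mul]; rw [← h2, ← k2]; ring
  · simp only [map_add, map_mul]; rw [← h3, ← k3]; ring
lemma Ev.mul {x y : Fq} {c d : ℂ} (h : Ev z x c) (k : Ev z y d) : Ev z (x*y) (c*d) := by
  obtain ⟨a, b, h1, h2, h3⟩ := h
  obtain ⟨a', b', k1, k2, k3⟩ := k
  refine ⟨a*a', b*b', by rw [map_mul]; exact mul_ne_zero h1 k1, ?_, ?_⟩
  · simp only [map_mul]; rw [← h2, ← k2]; ring
  · simp only [map_mul]; rw [← h3, ← k3]; ring
lemma Ev.neg {x : Fq} {c : ℂ} (h : Ev z x c) : Ev z (-x) (-c) := by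
  obtain ⟨a, b, h1, h2, h3⟩ := h
  exact ⟨-a, b, h1, by rw [map_neg, ← h2]; ring, by rw [map_neg, ← h3]; ring⟩
lemma Ev.sub {x y : Fq} {c d : ℂ} (h : Ev z x c) (k : Ev z y d) : Ev z (x-y) (c-d) := by
  rw [sub_eq_add_neg, sub_eq_add_neg]; exact h.add k.neg
lemma Ev.inv {x : Fq} {c : ℂ} (h : Ev z x c) (hc : c ≠ 0) : Ev z x⁻¹ c⁻¹ := by
  obtain ⟨a, b, h1, h2, h3⟩ := h
  have ha : aeval z a ≠ 0 := by rw [← h3]; exact mul_ne_zero hc h1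
  have hx : x ≠ 0 := by
    rintro rfl
    rw [zero_mul] at h2
    have : a = 0 := iot_inj (h2.symm.trans (map_zero iot).symm)
    simp [this] at ha
  refine ⟨b, a, ha, ?_, ?_⟩
  · rw [← h2]; field_simp
  · rw [← h3]; field_simp
lemma Ev.div {x y : Fq} {c d : ℂ} (h : Ev z x c) (k : Ev z y d) (hd : d ≠ 0) : Ev z (x/y) (c/d) := by
  rw [div_eq_mul_inv, div_eq_mul_inv]; exact h.mul (k.inv hd)
lemma Ev.pow {x : Fq} {c : ℂ} (h : Ev z x c) (n : ℕ) : Ev z (x^n) (c^n) := by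
  induction n with
  | zero => simpa using Ev_one z
  | succ n ih => rw [pow_succ, pow_succ]; exact ih.mul h
lemma Ev_prod {f : ℕ → Fq} {g : ℕ → ℂ} (s : Finset ℕ) (h : ∀ i ∈ s, Ev z (f i) (g i)) :
    Ev z (∏ i ∈ s, f i) (∏ i ∈ s, g i) := by
  induction s using Finset.induction_on with
  | empty => simpa using Ev_one z
  | insert a s ha ih =>
    rw [prod_insert ha, prod_insert ha]
    exact (h a (mem_insert_self _ _)).mul (ih fun i hi => h i (mem_insert_of_mem hi))

def Va (p : ℕ) (z : ℂ) (k : ℤ) (x : Fq) : Prop := ∃ y c, Ev z y c ∧ x = qInt p ^ k * y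

lemma Ev.va {p : ℕ} {x : Fq} {c : ℂ} (h : Ev z x c) : Va p z 0 x := ⟨x, c, h, by simp⟩
lemma Va.mul {p : ℕ} (hp : p.Prime) {x y : Fq} {k l : ℤ} (h : Va p z k x) (h' : Va p z l y) :
    Va p z (k+l) (x*y) := by
  obtain ⟨a, c, h1, rfl⟩ := h
  obtain ⟨b, d, h2, rfl⟩ := h'
  refine ⟨a*b, c*d, h1.mul h2, ?_⟩
  rw [zpow_add₀ (qInt_ne p hp)]; ring
lemma Va.add {p : ℕ} {x y : Fq} {k : ℤ} (h : Va p z k x) (h' : Va p z k y) :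
    Va p z k (x+y) := by
  obtain ⟨a, c, h1, rfl⟩ := h
  obtain ⟨b, d, h2, rfl⟩ := h'
  exact ⟨a+b, c+d, h1.add h2, by ring⟩
lemma Va_sum {p : ℕ} {k : ℤ} {f : ℕ → Fq} (s : Finset ℕ) (h : ∀ i ∈ s, Va p z k (f i)) :
    Va p z k (∑ i ∈ s, f i) := by
  induction s using Finset.induction_on with
  | empty => exact ⟨0, 0, Ev_zero z, by simp⟩
  | insert a s ha ih =>
    rw [sum_insert ha]
    exact (h a (mem_insert_self _ _)).add (ih fun i hi => h i (mem_insert_of_mem hi))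
lemma Va_prod {p : ℕ} (hp : p.Prime) {k : ℕ → ℤ} {f : ℕ → Fq} (s : Finset ℕ)
    (h : ∀ i ∈ s, Va p z (k i) (f i)) : Va p z (∑ i ∈ s, k i) (∏ i ∈ s, f i) := by
  induction s using Finset.induction_on with
  | empty => simpa using (Ev_one z).va
  | insert a s ha ih =>
    rw [sum_insert ha, prod_insert ha]
    exact (h a (mem_insert_self _ _)).mul hp (ih fun i hi => h i (mem_insert_of_mem hi))

lemma dvd_of_aeval {p : ℕ} (hp : p.Prime) (hz : IsPrimitiveRoot z p) {a : ℤ[X]} (h : aeval z a = 0) :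
    cyclotomic p ℤ ∣ a := by
  rw [cyclotomic_eq_minpoly hz hp.pos]
  exact minpoly.isIntegrallyClosed_dvd (hz.isIntegral hp.pos) h

lemma aeval_cyc {p : ℕ} (hp : p.Prime) (hz : IsPrimitiveRoot z p) : aeval z (cyclotomic p ℤ) = 0 := by
  rw [cyclotomic_eq_minpoly hz hp.pos]
  exact minpoly.aeval _ _

lemma Ev.va_one {p : ℕ} (hp : p.Prime) (hz : IsPrimitiveRoot z p) {x : Fq} (h : Ev z x 0) :
    Va p z 1 x := by
  obtain ⟨a, b, h1, h2, h3⟩ := h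
  rw [zero_mul] at h3
  obtain ⟨a', rfl⟩ := dvd_of_aeval hp hz h3.symm
  have hb : iot b ≠ 0 := by
    intro h
    have : b = 0 := iot_inj (h.trans (map_zero iot).symm)
    simp [this] at h1
  refine ⟨iot a' / iot b, aeval z a' / aeval z b, (Ev_iot z a').div (Ev_iot z b) h1, ?_⟩
  rw [map_mul, ← qInt_eq p hp] at h2
  rw [zpow_one]
  field_simp
  exact h2

noncomputable def Rq : Subring Fq := Subring.closure {q, q⁻¹}

lemma q_mem : q ∈ Rq := Subring.subset_closure (by simp)
lemma qi_mem : q⁻¹ ∈ Rq := Subring.subset_closure (by simp)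

lemma Rq_poly (x : Fq) (hx : x ∈ Rq) : ∃ (N : ℕ) (P : ℤ[X]), q ^ N * x = iot P := by
  unfold Rq at hx
  induction hx using Subring.closure_induction with
  | mem x hx =>
    rcases hx with rfl | hx
    · exact ⟨0, X, by simp [iot_X]⟩
    · rw [Set.mem_singleton_iff] at hx
      subst hx
      exact ⟨1, 1, by simp [q_ne]⟩
  | zero => exact ⟨0, 0, by simp⟩
  | one => exact ⟨0, 1, by simp⟩
  | add x y _ _ hx hy =>
    obtain ⟨N, P, h⟩ := hx
    obtain ⟨N', P', h'⟩ := hy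
    refine ⟨N+N', X^N' * P + X^N * P', ?_⟩
    simp only [map_add, map_mul, map_pow, iot_X]
    rw [← h, ← h']; ring
  | neg x _ hx =>
    obtain ⟨N, P, h⟩ := hx
    exact ⟨N, -P, by rw [map_neg, ← h]; ring⟩
  | mul x y _ _ hx hy =>
    obtain ⟨N, P, h⟩ := hx
    obtain ⟨N', P', h'⟩ := hy
    refine ⟨N+N', P * P', ?_⟩
    rw [map_mul, ← h, ← h']; ring

lemma laurent_rep (N : ℕ) (P : ℤ[X]) :
    ∃ f : ℤ →₀ ℤ, iot P = q ^ N * (f.sum fun i b => (b : Fq) * q ^ i) := by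
  induction P using Polynomial.induction_on' with
  | add P Q hP hQ =>
    obtain ⟨f, hf⟩ := hP
    obtain ⟨g, hg⟩ := hQ
    refine ⟨f + g, ?_⟩
    rw [Finsupp.sum_add_index', map_add, hf, hg]
    · ring
    · simp
    · intros; push_cast; ring
  | monomial n a =>
    refine ⟨Finsupp.single ((n:ℤ) - N) a, ?_⟩
    rw [Finsupp.sum_single_index (by simp), zpow_sub₀ q_ne, ← C_mul_X_pow_eq_monomial, map_mul,
      map_pow, iot_X]
    have := q_ne
    simp [iot]
    field_simp

lemma final_div {p : ℕ} (hp : p.Prime) (hz : IsPrimitiveRoot z p) (x : Fq) (hx : x ∈ Rq)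
    (h : Va p z 2 x) : ∃ f : ℤ →₀ ℤ, x = qInt p ^ 2 * (f.sum fun i b => (b : Fq) * q ^ i) := by
  obtain ⟨N, P, hP⟩ := Rq_poly x hx
  obtain ⟨y, c, ⟨a, b, h1, h2, -⟩, h4⟩ := h
  have e : P * b = cyclotomic p ℤ ^ 2 * (X ^ N * a) := by
    apply iot_inj
    simp only [map_mul, map_pow, iot_X]
    rw [← hP, ← h2, ← qInt_eq p hp, h4]
    norm_cast
    ring
  have hpr : Prime (cyclotomic p ℤ) := (cyclotomic.irreducible hp.pos).prime
  have hb : ¬ cyclotomic p ℤ ∣ b := by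
    rintro ⟨b', rfl⟩
    rw [map_mul, aeval_cyc hp hz, zero_mul] at h1
    exact h1 rfl
  obtain ⟨P', rfl⟩ : cyclotomic p ℤ ^ 2 ∣ P :=
    hpr.pow_dvd_of_dvd_mul_right 2 hb ⟨_, e⟩
  obtain ⟨f, hf⟩ := laurent_rep N P'
  refine ⟨f, ?_⟩
  apply mul_left_cancel₀ (pow_ne_zero N q_ne)
  rw [hP, map_mul, map_pow, ← qInt_eq p hp, hf]
  ring

lemma qBin_mem {F : Type*} [Field F] (q : F) (h1 : ∀ k, q ^ (k+1) ≠ 1) (S : Subring F) (hS : q ∈ S)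
    (n k : ℕ) : qBin q n k ∈ S := by
  have h2 : ∀ k, 1 - q ^ (k+1) ≠ 0 := fun k h => h1 k (by linear_combination -h)
  have h0 : ∀ n, qBin q n 0 = 1 := by
    intro n
    have := qPoch_ne q h1 n
    rw [qBin, if_pos (Nat.zero_le _), Nat.sub_zero,
      show qPoch q q 0 = 1 from prod_range_zero _, one_mul, div_self this]
  induction n generalizing k with
  | zero =>
    cases k with
    | zero => rw [h0]; exact S.one_mem
    | succ k => rw [qBin, if_neg (by omega)]; exact S.zero_mem
  | succ n ih =>
    cases k with
    | zero => rw [h0]; exact S.one_mem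
    | succ k =>
      have : qBin q (n+1) (k+1) = qBin q n k + q^(k+1) * qBin q n (k+1) := by
        rcases lt_trichotomy k n with h | h | h
        · obtain ⟨d, rfl⟩ := Nat.exists_eq_add_of_lt h
          rw [qBin, qBin, qBin, if_pos (by omega), if_pos (by omega), if_pos (by omega),
            show k + d + 1 + 1 - (k+1) = d + 1 by omega, show k + d + 1 - (k+1) = d by omega,
            show k + d + 1 - k = d + 1 by omega, qPoch_succ q (k+d+1), qPoch_succ q k, qPoch_succ q d]
          have a1 := qPoch_ne q h1 k
          have a2 := qPoch_ne q h1 d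
          have a3 := h2 k
          have a4 := h2 d
          field_simp
          ring
        · subst h
          have a1 := qPoch_ne q h1 k
          have a2 := qPoch_ne q h1 (k+1)
          rw [qBin, qBin, qBin, if_pos (by omega), if_pos (by omega), if_neg (by omega)]
          simp [qPoch] at *
          field_simp
        · rw [qBin, qBin, qBin, if_neg (by omega), if_neg (by omega), if_neg (by omega)]; ring
      rw [this]
      exact S.add_mem (ih _) (S.mul_mem (S.pow_mem hS _) (ih _))

lemma Dq_mem {F : Type*} [Field F] (q : F) (h1 : ∀ k, q ^ (k+1) ≠ 1) (S : Subring F) (hS : q ∈ S)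
    (m n : ℕ) : Dq q m n ∈ S := by
  unfold Dq
  apply S.sum_mem
  intro k _
  exact S.mul_mem (S.mul_mem (S.pow_mem hS _) (qBin_mem q h1 S hS _ _)) (qBin_mem q h1 S hS _ _)

lemma geom_mem {F : Type*} [Field F] (S : Subring F) (x : F) (hx : x ≠ 1) (hS : x ∈ S) (n : ℕ) :
    (1 - x ^ n) / (1 - x) ∈ S := by
  have : (1 - x ^ n) / (1 - x) = ∑ i ∈ range n, x ^ i := by
    rw [← geom_sum_mul_neg, mul_div_cancel_right₀]
    exact sub_ne_zero.2 hx.symm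
  rw [this]
  exact S.sum_mem fun i _ => S.pow_mem hS _

lemma LHS_mem (p m : ℕ) : (∑ k ∈ Finset.range p,
          (1 - q ^ (2 * k + 1)) / (1 - q) * Dq q m k * Dq q⁻¹ m k * (q ^ k)⁻¹) -
        (if p ∣ m then q * (1 - (q ^ (2 * m))⁻¹) / (1 - q ^ 2)
          else if p ∣ (m + 1) then q * (1 - q ^ (2 * m + 2)) / (1 - q ^ 2)
          else 0) ∈ Rq := by
  have h1' : ∀ k, q⁻¹ ^ (k+1) ≠ 1 := fun k h => q_pow_ne k (by simpa using h)
  have hq1 : q ≠ 1 := by simpa using q_pow_ne 0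
  apply Rq.sub_mem
  · apply Rq.sum_mem
    intro k _
    refine Rq.mul_mem (Rq.mul_mem (Rq.mul_mem (geom_mem Rq q hq1 q_mem _) ?_) ?_) ?_
    · exact Dq_mem q q_pow_ne Rq q_mem _ _
    · exact Dq_mem _ h1' Rq qi_mem _ _
    · rw [← inv_pow]; exact Rq.pow_mem qi_mem _
  · split_ifs
    · have e : q * (1 - (q ^ (2 * m))⁻¹) / (1 - q ^ 2) =
        -(q * q⁻¹ ^ (2*m) * ((1 - (q^2) ^ m) / (1 - q^2))) := by
        have := q_ne
        rw [← pow_mul, inv_pow]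
        field_simp
        ring
      rw [e]
      exact Rq.neg_mem (Rq.mul_mem (Rq.mul_mem q_mem (Rq.pow_mem qi_mem _))
        (geom_mem Rq _ (q_pow_ne 1) (Rq.pow_mem q_mem 2) m))
    · rw [show 2 * m + 2 = 2 * (m+1) by ring, pow_mul, mul_div_assoc]
      exact Rq.mul_mem q_mem (geom_mem Rq _ (q_pow_ne 1) (Rq.pow_mem q_mem 2) _)
    · exact Rq.zero_mem
end arith
section D
open Finset

lemma Ev_pa {z : ℂ} {M : Fq} {c : ℂ} (h : Ev z M c) (j : ℕ) : Ev z (pa q M j) (pa z c j) := by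
  unfold pa
  exact Ev_prod _ fun i _ => (Ev_one z).sub (h.mul ((Ev_q z).pow i))

lemma Ev_pb {z : ℂ} (hz0 : z ≠ 0) {M : Fq} {c : ℂ} (h : Ev z M c) (j : ℕ) :
    Ev z (pb q M j) (pb z c j) := by
  unfold pb
  exact Ev_prod _ fun i _ => (Ev_one z).sub (h.div ((Ev_q z).pow (i+1)) (pow_ne_zero _ hz0))

lemma Ev_phi {z : ℂ} (hz0 : z ≠ 0) {M : Fq} {c : ℂ} (hc : c ≠ 0) (h : Ev z M c) (j : ℕ) :
    Ev z (phi q M j) (phi z c j) := by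
  unfold phi
  exact ((Ev_pa ((Ev_q z).mul h) j).mul (Ev_pb hz0 ((Ev_q z).mul h) j)).div (h.pow j) (pow_ne_zero _ hc)

lemma one_sub_ne {z : ℂ} {p : ℕ} (hz : IsPrimitiveRoot z p) {a : ℕ} (h : ¬ p ∣ a) : 1 - z ^ a ≠ 0 := by
  intro h'
  exact h ((hz.pow_eq_one_iff_dvd a).1 (by linear_combination -h'))

lemma one_add_ne {z : ℂ} {s : ℕ} (hz : IsPrimitiveRoot z (2*s+3)) (a : ℕ) : 1 + z ^ a ≠ 0 := by
  intro h
  have h1 : z ^ a = -1 := by linear_combination h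
  have h2 : (z ^ a) ^ (2*s+3) = 1 := by rw [← pow_mul, mul_comm, pow_mul, hz.pow_eq_one, one_pow]
  rw [h1, Odd.neg_one_pow ⟨s+1, by ring⟩] at h2
  norm_num at h2

lemma pa_zero {z : ℂ} {c : ℂ} {j i : ℕ} (hi : i < j) (h : c * z^i = 1) : pa z c j = 0 := by
  unfold pa
  exact prod_eq_zero (mem_range.2 hi) (by rw [h, sub_self])

lemma pb_zero {z : ℂ} (hz0 : z ≠ 0) {c : ℂ} {j i : ℕ} (hi : i < j) (h : c = z^(i+1)) : pb z c j = 0 := by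
  unfold pb
  exact prod_eq_zero (mem_range.2 hi) (by rw [h, div_self (pow_ne_zero _ hz0), sub_self])

lemma pow_mod_eq {z : ℂ} {p : ℕ} (hz : IsPrimitiveRoot z p) (m : ℕ) : z ^ m = z ^ (m % p) := by
  conv_lhs => rw [← Nat.mod_add_div m p, pow_add, pow_mul, hz.pow_eq_one, one_pow, mul_one]

/-- pb part vanishes -/
lemma pb_van {z : ℂ} {p : ℕ} (hz : IsPrimitiveRoot z p) (hz0 : z ≠ 0) (m j : ℕ) (h : m % p < j) :
    pb z (z * z^m) j = 0 :=
  pb_zero hz0 h (by rw [pow_mod_eq hz m]; ring)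

lemma pa_van {z : ℂ} {p : ℕ} (hp0 : 0 < p) (hz : IsPrimitiveRoot z p) (m j : ℕ) (h : p - 1 - m % p < j) :
    pa z (z * z^m) j = 0 :=
  pa_zero h (by
    have := Nat.mod_lt m hp0
    rw [pow_mod_eq hz m, ← pow_succ', ← pow_add, show m % p + 1 + (p - 1 - m % p) = p by omega, hz.pow_eq_one])

lemma ww_va {z : ℂ} {s : ℕ} (hp : (2*s+3).Prime) (hz : IsPrimitiveRoot z (2*s+3)) (j : ℕ)
    (hj : j ≤ 2*s+2) : Va (2*s+3) z (if s+1 < j then -1 else 0) (ww q j) := by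
  have hz1 : 1 - z ≠ 0 := by
    have := one_sub_ne hz (a := 1) (by intro h; have := Nat.le_of_dvd one_pos h; omega)
    simpa using this
  have key := Va_prod (z := z) hp (k := fun i => if i = s+1 then -1 else 0)
    (f := fun i => q^(2*i+1)*(1+q^i)/((1-q^(i+1))^3*(1-q^(2*i+1)))) (range j) (by
    intro i hi
    rw [mem_range] at hi
    have hd : 1 - z^(i+1) ≠ 0 := one_sub_ne hz (by
      intro h; have := Nat.le_of_dvd (by omega) h; omega)
    have hN : Ev z (q^(2*i+1)*(1+q^i)) (z^(2*i+1)*(1+z^i)) :=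
      ((Ev_q z).pow _).mul ((Ev_one z).add ((Ev_q z).pow _))
    have hD : Ev z ((1-q^(i+1))^3) ((1-z^(i+1))^3) := ((Ev_one z).sub ((Ev_q z).pow _)).pow 3
    by_cases h : i = s+1
    · subst h
      simp only [if_true]
      refine ⟨_, _, hN.div (hD.mul ((Ev_one z).sub (Ev_q z))) (mul_ne_zero (pow_ne_zero _ hd) hz1), ?_⟩
      rw [show 2*(s+1)+1 = 2*s+3 by ring, qInt_mul (2*s+3)]
      have h1 := qInt_ne _ hp
      have h2 := one_sub_q_pow_ne (s+1)
      have h3 := one_sub_q_pow_ne 0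
      rw [zero_add, pow_one] at h3
      rw [zpow_neg_one]
      field_simp
    · simp only [h, if_false]
      refine (hN.div (hD.mul ((Ev_one z).sub ((Ev_q z).pow _))) (mul_ne_zero (pow_ne_zero _ hd) ?_)).va
      refine one_sub_ne hz ?_
      rintro ⟨c, hc⟩
      have h2 : c < 2 := by
        by_contra h2
        have : (2*s+3)*2 ≤ (2*s+3)*c := Nat.mul_le_mul_left _ (by omega)
        omega
      interval_cases c <;> omega)
  rw [Finset.sum_ite_eq'] at key
  simpa [ww] using key
lemma Va.congr {p : ℕ} {z : ℂ} {k l : ℤ} {x y : Fq} (h : Va p z k x) (e : k = l) (e' : x = y) :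
    Va p z l y := by subst e; subst e'; exact h

lemma one_sub_z {z : ℂ} {s : ℕ} (hz : IsPrimitiveRoot z (2*s+3)) : 1 - z ≠ 0 := by
  have := one_sub_ne hz (a := 1) (by intro h; have := Nat.le_of_dvd one_pos h; omega)
  simpa using this

lemma tau_va {z : ℂ} {s : ℕ} (hp : (2*s+3).Prime) (hz : IsPrimitiveRoot z (2*s+3)) (m j : ℕ)
    (hj : j < 2*s+2) : Va (2*s+3) z 2 (ww q j * phi q (q^m) j *
      (q^(j+1) * phi q (q^(2*s+3)) j * (1 - q^(2*s+3)) * (1 - q^(2*s+3)/q^j) /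
        (q^(2*s+3) * (1 - q^(j+1)))) / (1 - q)) := by
  have hz0 : z ≠ 0 := hz.ne_zero (by omega)
  have hz1 := one_sub_z hz
  have hd : 1 - z^(j+1) ≠ 0 := one_sub_ne hz (by
      intro h; have := Nat.le_of_dvd (by omega) h; omega)
  have hq := Ev_q z
  have h1 : Va (2*s+3) z 1 (phi q (q^(2*s+3)) j * (1 - q^(2*s+3)/q^j)) := by
    have := (Ev_phi hz0 (pow_ne_zero _ hz0) (hq.pow (2*s+3)) j).mul
      ((Ev_one z).sub ((hq.pow (2*s+3)).div (hq.pow j) (pow_ne_zero _ hz0)))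
    apply Ev.va_one hp hz
    convert this using 1
    rcases Nat.eq_zero_or_pos j with h | h
    · subst h; simp [hz.pow_eq_one]
    · unfold phi
      rw [pb_van hz hz0 (2*s+3) j (by simpa using h)]; simp
  have h2 : Va (2*s+3) z 1 (1 - q^(2*s+3)) := by
    apply Ev.va_one hp hz
    convert (Ev_one z).sub (hq.pow (2*s+3)) using 1
    rw [hz.pow_eq_one, sub_self]
  have h3 : Va (2*s+3) z 0 (q^(j+1) / (q^(2*s+3) * (1 - q^(j+1))) / (1 - q)) :=
    (((hq.pow (j+1)).div ((hq.pow (2*s+3)).mul ((Ev_one z).sub (hq.pow (j+1))))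
      (mul_ne_zero (pow_ne_zero _ hz0) hd)).div ((Ev_one z).sub hq) hz1).va
  have h4 : Va (2*s+3) z 0 (ww q j * phi q (q^m) j) := by
    have w := ww_va hp hz j (by omega)
    have f := Ev_phi hz0 (pow_ne_zero m hz0) (hq.pow m) j
    by_cases h : s + 1 < j
    · rw [if_pos h] at w
      have : phi z (z^m) j = 0 := by
        unfold phi
        by_cases h' : m % (2*s+3) < j
        · rw [pb_van hz hz0 m j h']; simp
        · rw [pa_van (by omega) hz m j (by omega)]; simp
      rw [this] at f
      exact (w.mul hp (f.va_one hp hz)).congr (by norm_num) rfl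
    · rw [if_neg h] at w
      exact (w.mul hp f.va).congr (by norm_num) rfl
  refine (((h4.mul hp h1).mul hp h2).mul hp h3).congr (by norm_num) ?_
  ring

/-- complex identities -/
lemma prodA {z : ℂ} {s : ℕ} (hz : IsPrimitiveRoot z (2*s+3)) :
    ∏ i ∈ range (2*s+2), (1 - z^(i+1)) = (2*s+3 : ℂ) := by
  have := IsPrimitiveRoot.prod_one_sub_pow_eq_order (n := 2*s+2) hz
  rw [this]; push_cast; ring

lemma prodPlus {z : ℂ} {s : ℕ} (hz : IsPrimitiveRoot z (2*s+3)) :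
    ∏ i ∈ range (2*s+2), (1 + z^(i+1)) = 1 := by
  have h2 : IsPrimitiveRoot (z^2) (2*s+3) := hz.pow_of_coprime 2 (by
    rw [show 2*s+3 = 1 + 2*(s+1) by ring]; simp)
  have a := prodA hz
  have b := prodA h2
  have c : ∏ i ∈ range (2*s+2), (1 - (z^2)^(i+1)) =
     (∏ i ∈ range (2*s+2), (1 - z^(i+1))) * ∏ i ∈ range (2*s+2), (1 + z^(i+1)) := by
    rw [← prod_mul_distrib]
    apply prod_congr rfl; intros; ring
  rw [a, b] at c
  have h : (2*s+3 : ℂ) ≠ 0 := by norm_cast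
  exact (mul_left_cancel₀ h (by rw [← c, mul_one])).symm

lemma prodN {z : ℂ} {s : ℕ} (hz : IsPrimitiveRoot z (2*s+3)) :
    (∏ i ∈ range (2*s+2), (z^(2*i+1) * (1 + z^i))) * (1 + z) = 2 * z^2 := by
  have hz0 : z ≠ 0 := hz.ne_zero (by omega)
  rw [prod_mul_distrib]
  have e : ∀ n, ∏ i ∈ range n, z^(2*i+1) = z^(n^2) := by
    intro n
    induction n with
    | zero => simp
    | succ n ih => rw [prod_range_succ, ih]; ring
  have f := prodPlus hz
  have g : (∏ i ∈ range (2*s+2), (1 + z^i)) * (1 + z^(2*s+2)) = 2 := by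
    have := prod_range_succ (fun i => 1 + z^i) (2*s+2)
    rw [← this, prod_range_succ', f]; norm_num
  have h : z^(2*s+2) * z = 1 := by rw [← pow_succ]; exact hz.pow_eq_one
  have k : z^((2*s+2)^2) = z := by
    rw [show (2*s+2)^2 = (2*s+3)*(2*s+1) + 1 by ring, pow_succ, pow_mul, hz.pow_eq_one]; simp
  rw [e, k]
  have : 1 + z = (1 + z^(2*s+2)) * z := by linear_combination -h
  rw [this]
  linear_combination z^2 * g

lemma prodE {z : ℂ} {s : ℕ} (hz : IsPrimitiveRoot z (2*s+3)) :
    ((∏ i ∈ range (s+1), (1 - z^(2*i+1))) * ∏ t ∈ range s, (1 - z^(2*(s+2+t)+1))) * (z - 1) =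
      (2*s+3 : ℂ) * z := by
  rw [← prodA hz]
  have e : ∀ n, ∏ i ∈ range (2*n), (1 - z^(i+1)) =
     (∏ i ∈ range n, (1 - z^(2*i+1))) * ∏ i ∈ range n, (1 - z^(2*i+2)) := by
    intro n
    induction n with
    | zero => simp
    | succ n ih => rw [mul_add, mul_one, prod_range_succ, prod_range_succ, ih, prod_range_succ, prod_range_succ]; ring
  rw [show 2*s+2 = 2*(s+1) by ring, e, prod_range_succ (fun i => 1 - z^(2*i+2))]
  have f : ∏ t ∈ range s, (1 - z^(2*(s+2+t)+1)) = ∏ i ∈ range s, (1 - z^(2*i+2)) := by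
    apply prod_congr rfl; intro t _
    rw [show 2*(s+2+t)+1 = (2*s+3) + (2*t+2) by ring, pow_add, hz.pow_eq_one, one_mul]
  have h : z^(2*s+2) * z = 1 := by rw [← pow_succ]; exact hz.pow_eq_one
  rw [f]
  linear_combination (∏ i ∈ range (s+1), (1 - z^(2*i+1))) * (∏ i ∈ range s, (1 - z^(2*i+2))) * h

lemma paA {z : ℂ} {s : ℕ} (hz : IsPrimitiveRoot z (2*s+3)) : pa z z (2*s+2) = (2*s+3 : ℂ) := by
  rw [← prodA hz]; unfold pa
  apply prod_congr rfl; intros; ring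

lemma pbA {z : ℂ} {s : ℕ} (hz : IsPrimitiveRoot z (2*s+3)) : pb z 1 (2*s+2) = (2*s+3 : ℂ) := by
  rw [← prodA hz.inv]; unfold pb
  apply prod_congr rfl; intros; rw [inv_pow, one_div]

lemma pbC {z : ℂ} {s : ℕ} (hz : IsPrimitiveRoot z (2*s+3)) : pb z 1 (2*s+1) * (1 - z) = (2*s+3 : ℂ) := by
  have := pbA hz
  rw [pb_succ] at this
  rw [← this]
  congr 2
  rw [eq_div_iff (pow_ne_zero _ (hz.ne_zero (by omega))), ← pow_succ']; exact hz.pow_eq_one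

/-- pa starting at 1 shifted: `∏_{i<2s+1} (1 - z^(i+1))` -/
lemma paC {z : ℂ} {s : ℕ} (hz : IsPrimitiveRoot z (2*s+3)) : pa z z (2*s+1) * (z - 1) = (2*s+3 : ℂ) * z := by
  have := paA hz
  rw [pa_succ] at this
  have h : z^(2*s+1) * z * z = 1 := by rw [← pow_succ, ← pow_succ]; exact hz.pow_eq_one
  rw [← this]
  linear_combination pa z z (2*s+1) * h
end D
section E
open Finset

lemma ww_last (s : ℕ) : ww q (2*s+2) * (1 - q^(2*s+3)) =
    (∏ i ∈ range (2*s+2), (q^(2*i+1) * (1 + q^i))) / ((∏ i ∈ range (2*s+2), (1 - q^(i+1)))^3 *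
     ((∏ i ∈ range (s+1), (1 - q^(2*i+1))) * ∏ t ∈ range s, (1 - q^(2*(s+2+t)+1)))) := by
  have e : ∏ i ∈ range (2*s+2), (1 - q^(2*i+1)) =
    ((∏ i ∈ range (s+1), (1 - q^(2*i+1))) * ∏ t ∈ range s, (1 - q^(2*(s+2+t)+1))) * (1 - q^(2*s+3)) := by
    rw [show 2*s+2 = (s+2) + s by ring, prod_range_add, prod_range_succ,
      show 2*(s+1)+1 = 2*s+3 by ring]
    ring
  unfold ww
  rw [prod_div_distrib, prod_mul_distrib (f := fun i => (1 - q^(i+1))^3), prod_pow, e]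
  have h := one_sub_q_pow_ne (2*s+2)
  rw [← mul_assoc, div_mul_eq_mul_div, mul_div_mul_right _ _ h]

lemma W_ev {z : ℂ} {s : ℕ} (hz : IsPrimitiveRoot z (2*s+3)) :
    ∃ ω, Ev z (ww q (2*s+2) * phi q (q^(2*s+3)) (2*s+2)) ω ∧ ω * (1+z) * (2*s+3)^2 = -2*z := by
  have hz0 : z ≠ 0 := hz.ne_zero (by omega)
  have hz1 := one_sub_z hz
  have hz2 : 1 + z ≠ 0 := by simpa using one_add_ne hz 1
  have hP : (2*s+3 : ℂ) ≠ 0 := by norm_cast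
  have hq := Ev_q z
  have hN : Ev z (∏ i ∈ range (2*s+2), (q^(2*i+1) * (1 + q^i))) (∏ i ∈ range (2*s+2), (z^(2*i+1) * (1 + z^i))) :=
    Ev_prod _ fun i _ => (hq.pow _).mul ((Ev_one z).add (hq.pow _))
  have hA : Ev z (∏ i ∈ range (2*s+2), (1 - q^(i+1))) (2*s+3) := by
    rw [← prodA hz]
    exact Ev_prod _ fun i _ => (Ev_one z).sub (hq.pow _)
  have hE : Ev z ((∏ i ∈ range (s+1), (1 - q^(2*i+1))) * ∏ t ∈ range s, (1 - q^(2*(s+2+t)+1)))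
    ((∏ i ∈ range (s+1), (1 - z^(2*i+1))) * ∏ t ∈ range s, (1 - z^(2*(s+2+t)+1))) :=
    (Ev_prod _ fun i _ => (Ev_one z).sub (hq.pow _)).mul (Ev_prod _ fun i _ => (Ev_one z).sub (hq.pow _))
  have iN := prodN hz
  have iE := prodE hz
  generalize (∏ i ∈ range (2*s+2), (z^(2*i+1) * (1 + z^i))) = N at *
  generalize ((∏ i ∈ range (s+1), (1 - z^(2*i+1))) * ∏ t ∈ range s, (1 - z^(2*(s+2+t)+1))) = E at *
  have hE0 : E ≠ 0 := by
    rintro rfl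
    rw [zero_mul] at iE
    exact mul_ne_zero hP hz0 iE.symm
  have hpa := Ev_pa (hq.mul (hq.pow (2*s+3))) (2*s+2)
  have hpb := Ev_pb hz0 (hq.pow (2*s+3)) (2*s+1)
  rw [hz.pow_eq_one, mul_one, paA hz] at hpa
  rw [hz.pow_eq_one] at hpb
  have iC := pbC hz
  generalize pb z 1 (2*s+1) = C at *
  have h := (hN.div ((hA.pow 3).mul hE) (mul_ne_zero (pow_ne_zero _ hP) hE0)).mul
    ((hpa.mul hpb).div ((hq.pow (2*s+3)).pow (2*s+2)) (pow_ne_zero _ (pow_ne_zero _ hz0)))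
  rw [hz.pow_eq_one, one_pow] at h
  refine ⟨N / ((2*s+3)^3*E) * ((2*s+3) * C / 1), ?_, ?_⟩
  · convert h using 1
    rw [← ww_last, phi, pb_shift _ _ q_ne]
    ring
  · have hC : C = (2*s+3)/(1-z) := by rw [eq_div_iff hz1]; exact iC
    have hN' : N = 2*z^2/(1+z) := by rw [eq_div_iff hz2]; exact iN
    have hz3 : z - 1 ≠ 0 := fun h => hz1 (by linear_combination -h)
    have hE' : E = (2*s+3)*z/(z-1) := by rw [eq_div_iff hz3]; exact iE
    rw [hC, hN', hE']
    field_simp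
    ring

lemma last_va {z : ℂ} {s : ℕ} (hp : (2*s+3).Prime) (hz : IsPrimitiveRoot z (2*s+3)) (m : ℕ) :
    Va (2*s+3) z 2 (ww q (2*s+2) * phi q (q^m) (2*s+2) * phi q (q^(2*s+3)) (2*s+2) -
      (if (2*s+3) ∣ m then q * (1 - (q ^ (2 * m))⁻¹) / (1 - q ^ 2)
          else if (2*s+3) ∣ (m + 1) then q * (1 - q ^ (2 * m + 2)) / (1 - q ^ 2)
          else 0)) := by
  have hz0 : z ≠ 0 := hz.ne_zero (by omega)
  have hz1 := one_sub_z hz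
  have hz2 : 1 + z ≠ 0 := by simpa using one_add_ne hz 1
  have hz3 : z - 1 ≠ 0 := fun h => hz1 (by linear_combination -h)
  have hz4 : 1 - z^2 ≠ 0 := by
    rw [show 1 - z^2 = (1-z)*(1+z) by ring]; exact mul_ne_zero hz1 hz2
  have hP : (2*s+3 : ℂ) ≠ 0 := by norm_cast
  have hq := Ev_q z
  have q2 := one_sub_q_pow_ne 1
  norm_num at q2
  obtain ⟨ω, hW, iW⟩ := W_ev hz
  have hω : ω = -2*z/((1+z)*(2*s+3)^2) := by
    rw [eq_div_iff (mul_ne_zero hz2 (pow_ne_zero _ hP)), ← iW]; ring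
  have ephi : phi q (q^m) (2*s+2) = pa q (q*q^m) (2*s+2) * pb q (q*q^m) (2*s+2) / (q^m)^(2*s+2) := rfl
  split_ifs with h h'
  · have zm : z^m = 1 := (hz.pow_eq_one_iff_dvd m).2 h
    have h1 : Va (2*s+3) z 1 (1 - q^m) := by
      apply Ev.va_one hp hz
      convert (Ev_one z).sub (hq.pow m) using 1
      rw [zm, sub_self]
    have hpa := Ev_pa (hq.mul (hq.pow m)) (2*s+2)
    have hpb := Ev_pb hz0 (hq.pow m) (2*s+1)
    rw [zm, mul_one, paA hz] at hpa
    rw [zm] at hpb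
    have iC := pbC hz
    generalize pb z 1 (2*s+1) = C at *
    have hg := (hpa.mul hpb).div ((hq.pow m).pow (2*s+2)) (pow_ne_zero _ (pow_ne_zero _ hz0))
    have hh := (hq.mul ((Ev_one z).add (hq.pow m))).div ((hq.pow (2*m)).mul ((Ev_one z).sub (hq.pow 2)))
      (mul_ne_zero (pow_ne_zero _ hz0) hz4)
    have h2 := (hW.mul hg).add hh
    have h2z : ω * ((2*s+3) * C / (z^m)^(2*s+2)) + z*(1+z^m)/(z^(2*m)*(1-z^2)) = 0 := by
      have hC : C = (2*s+3)/(1-z) := by rw [eq_div_iff hz1]; exact iC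
      rw [mul_comm 2 m, pow_mul, zm, hC, hω, show 1 - z^2 = (1-z)*(1+z) by ring]
      simp only [one_pow]
      field_simp
      ring
    rw [h2z] at h2
    refine (h1.mul hp (h2.va_one hp hz)).congr (by norm_num) ?_
    rw [ephi, pb_shift _ _ q_ne]
    have e : q * (1 - (q ^ (2 * m))⁻¹) / (1 - q ^ 2) =
       - ((1 - q^m) * (q * (1 + q^m) / (q^(2*m) * (1 - q^2)))) := by
      have := q_ne
      rw [mul_comm 2 m, pow_mul]
      field_simp
      ring
    rw [e]
    ring
  · have zm : z*z^m = 1 := by rw [← pow_succ']; exact (hz.pow_eq_one_iff_dvd (m+1)).2 h'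
    have h1 : Va (2*s+3) z 1 (1 - q*q^m) := by
      apply Ev.va_one hp hz
      convert (Ev_one z).sub (hq.mul (hq.pow m)) using 1
      rw [zm, sub_self]
    have hpa := Ev_pa (hq.mul (hq.mul (hq.pow m))) (2*s+1)
    have hpb := Ev_pb hz0 (hq.mul (hq.pow m)) (2*s+2)
    rw [zm, mul_one] at hpa
    rw [zm, pbA hz] at hpb
    have iC := paC hz
    generalize pa z z (2*s+1) = C at *
    have hg := (hpa.mul hpb).div ((hq.pow m).pow (2*s+2)) (pow_ne_zero _ (pow_ne_zero _ hz0))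
    have hh := (hq.mul ((Ev_one z).add (hq.mul (hq.pow m)))).div ((Ev_one z).sub (hq.pow 2)) hz4
    have zz : (z^m)^(2*s+2) = z := by
      have : (z^m)^(2*s+2) * z^m = 1 := by
        rw [← pow_succ, ← pow_mul, mul_comm, pow_mul, hz.pow_eq_one, one_pow]
      calc (z^m)^(2*s+2) = (z^m)^(2*s+2) * (z * z^m) := by rw [zm, mul_one]
        _ = z := by linear_combination z * this
    have h2 := (hW.mul hg).sub hh
    have h2z : ω * (C * (2*s+3) / (z^m)^(2*s+2)) - z*(1+z*z^m)/(1-z^2) = 0 := by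
      have hC : C = (2*s+3)*z/(z-1) := by rw [eq_div_iff hz3]; exact iC
      rw [zz, zm, hC, hω, show 1 - z^2 = -((z-1)*(1+z)) by ring]
      field_simp
      ring
    rw [h2z] at h2
    refine (h1.mul hp (h2.va_one hp hz)).congr (by norm_num) ?_
    rw [ephi, pa_shift q (q*q^m) (2*s+1)]
    rw [show 2*m+2 = 2*(m+1) by ring, mul_comm 2 (m+1), pow_mul, pow_succ' q m]
    ring
  · have h1 : Va (2*s+3) z 1 (pa q (q*q^m) (2*s+2)) := by
      apply Ev.va_one hp hz
      convert Ev_pa (hq.mul (hq.pow m)) (2*s+2) using 1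
      have : m % (2*s+3) ≠ 0 := fun h0 => h (Nat.dvd_of_mod_eq_zero h0)
      rw [pa_van (by omega) hz m _ (by omega)]
    have h2 : Va (2*s+3) z 1 (pb q (q*q^m) (2*s+2)) := by
      apply Ev.va_one hp hz
      convert Ev_pb hz0 (hq.mul (hq.pow m)) (2*s+2) using 1
      have h3 : m % (2*s+3) < 2*s+3 := Nat.mod_lt _ (by omega)
      have : m % (2*s+3) ≠ 2*s+2 := fun h0 => h' (by
        rw [Nat.dvd_iff_mod_eq_zero, Nat.add_mod, h0, Nat.mod_eq_of_lt (show 1 < 2*s+3 by omega)]; simp)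
      rw [pb_van hz hz0 m _ (by omega)]
    have h3 : Ev z _ _ := hW.div ((hq.pow m).pow (2*s+2)) (pow_ne_zero _ (pow_ne_zero _ hz0))
    refine ((h1.mul hp h2).mul hp h3.va).congr (by norm_num) ?_
    rw [ephi]
    ring

end E

theorem Dq_sum_congruence (p m : ℕ) (hp : p.Prime) (hodd : Odd p) (hm : 0 < m) :
    ∃ f : ℤ →₀ ℤ,
      (∑ k ∈ Finset.range p,
          (1 - q ^ (2 * k + 1)) / (1 - q) * Dq q m k * Dq q⁻¹ m k * (q ^ k)⁻¹) -
        (if p ∣ m then q * (1 - (q ^ (2 * m))⁻¹) / (1 - q ^ 2)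
          else if p ∣ (m + 1) then q * (1 - q ^ (2 * m + 2)) / (1 - q ^ 2)
          else 0) =
      qInt p ^ 2 * (f.sum fun i b => (b : Fq) * q ^ i) := by
  have hz := Complex.isPrimitiveRoot_exp p hp.ne_zero
  generalize Complex.exp (2 * Real.pi * Complex.I / p) = z at hz
  obtain ⟨s, rfl⟩ : ∃ s, p = 2*s+3 := by
    obtain ⟨r, hr⟩ := hodd
    have := hp.two_le
    exact ⟨r-1, by omega⟩
  refine final_div hp hz _ (LHS_mem _ m) ?_
  rw [main_sum q q_ne q_pow_ne, sum_range_succ, add_sub_assoc]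
  refine (Va_sum _ fun j hj => tau_va hp hz m j (mem_range.1 hj)).add ?_
  refine (last_va hp hz m).congr rfl ?_
  congr 1
  have h1 := one_sub_q_pow_ne (2*s+2)
  have h3 := one_sub_q_pow_ne 0
  rw [zero_add, pow_one] at h3
  have h4 := q_ne
  have h5 : q^(2*s+3)/q^(2*s+2) = q := by rw [pow_succ]; field_simp
  rw [h5]
  rw [show 2*s+2+1 = 2*s+3 by ring] at h1 ⊢
  have h6 : q^(2*s+3) ≠ 0 := pow_ne_zero _ h4
  generalize q^(2*s+3) = Q at *
  field_simp
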